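/- For any finite-range interactions the set of ground-state configurations is non-empty: for every d ≥ 1, every finite set S, every finite B ⊂ ℤ^d and every f : (B → S) → ℝ, there exists a configuration X : ℤ^d → S which is a ground-state configuration of f. -/

import Mathlib

/-- The window of the configuration `X : ℤ^d → S` at `a`: the restriction of `X` to `a + B`,
translated back to `B`. -/
def window {d : ℕ} {S : Type*} (B : Finset (Fin d → ℤ)) (X : (Fin d → ℤ) → S)
    (a : Fin d → ℤ) : ↥B → S :=
  fun b => X (a + (b : Fin d → ℤ))

/-- `Y` is a local excitation of `X`: they differ at finitely many sites. -/
def LocalExc {d : ℕ} {S : Type*} (Y X : (Fin d → ℤ) → S) : Prop :=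
  {a : Fin d → ℤ | Y a ≠ X a}.Finite

/-- `X` is a ground-state configuration of the finite-range interaction `f`:
`H(Y|X) = Σ_a [f(Y_{a+B}) − f(X_{a+B})] ≥ 0` (a finite sum) for every local excitation `Y`. -/
def IsGroundState {d : ℕ} {S : Type*} (B : Finset (Fin d → ℤ))
    (f : (↥B → S) → ℝ) (X : (Fin d → ℤ) → S) : Prop :=
  ∀ Y : (Fin d → ℤ) → S, LocalExc Y X →
    0 ≤ ∑ᶠ a : Fin d → ℤ, (f (window B Y a) - f (window B X a))

/-- For every finite region some configuration minimises the energy of the windows based in it. -/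
theorem exists_forall_sum_window_le {d : ℕ} {S : Type*} [Finite S] [Nonempty S]
    (B : Finset (Fin d → ℤ)) (f : (↥B → S) → ℝ) (Λ : Finset (Fin d → ℤ)) :
    ∃ Z : (Fin d → ℤ) → S, ∀ Y : (Fin d → ℤ) → S,
      ∑ a ∈ Λ, f (window B Z a) ≤ ∑ a ∈ Λ, f (window B Y a) := by
  let E : (↥Λ → ↥B → S) → ℝ := fun w => ∑ a, f (w a)
  let W : ((Fin d → ℤ) → S) → ↥Λ → ↥B → S := fun Z a => window B Z a
  obtain ⟨w, hw⟩ := Finite.exists_min (fun w : Set.range W => E w)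
  obtain ⟨Z, hZ⟩ := w.2
  refine ⟨Z, fun Y => ?_⟩
  have key := hw ⟨W Y, Y, rfl⟩
  simp only [← hZ] at key
  rw [← Finset.sum_coe_sort Λ, ← Finset.sum_coe_sort Λ]
  exact key

/-- A net of configurations over a finite alphabet has a pointwise limit along any ultrafilter. -/
theorem Ultrafilter.exists_forall_eventually_eq {ι α S : Type*} [Finite S] (U : Ultrafilter ι)
    (Z : ι → α → S) : ∃ X : α → S, ∀ a, ∀ᶠ i in U, Z i a = X a := by
  have h : ∀ a, ∃ s, ∀ᶠ i in U, Z i a = s := fun a => by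
    obtain ⟨s, hs⟩ := (U.map fun i => Z i a).eq_pure_of_finite
    refine ⟨s, ?_⟩
    have : {s} ∈ U.map fun i => Z i a := by rw [hs]; exact rfl
    exact this
  choose X hX using h
  exact ⟨X, hX⟩

/-- For any finite-range interaction the set of ground-state configurations
is non-empty. -/
theorem exists_ground_state
    (d : ℕ) (hd : 1 ≤ d) (S : Type*) [Fintype S] [Nonempty S]
    (B : Finset (Fin d → ℤ)) (f : (↥B → S) → ℝ) :
    ∃ X : (Fin d → ℤ) → S, IsGroundState B f X := by
  classical
  choose Z hZ using exists_forall_sum_window_le B f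
  let U : Ultrafilter (Finset (Fin d → ℤ)) := Ultrafilter.of Filter.atTop
  obtain ⟨X, hX⟩ := U.exists_forall_eventually_eq Z
  refine ⟨X, fun Y hY => ?_⟩
  let D : Finset (Fin d → ℤ) := hY.toFinset
  have hD : ∀ a, a ∉ D → Y a = X a := fun a ha =>
    not_not.1 fun h => ha (hY.mem_toFinset.2 h)
  let T : Finset (Fin d → ℤ) := Finset.image₂ (fun x b => x - b) D B
  have hT : ∀ a, a ∉ T → ∀ b ∈ B, a + b ∉ D := fun a ha b hb hab =>
    ha (Finset.mem_image₂.2 ⟨a + b, hab, b, hb, by simp⟩)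
  rw [finsum_eq_sum_of_support_subset (s := T)]
  · have h₁ : ∀ᶠ Λ in (U : Filter (Finset (Fin d → ℤ))), T ⊆ Λ :=
      Ultrafilter.of_le Filter.atTop (Filter.eventually_ge_atTop T)
    have h₂ : ∀ᶠ Λ in (U : Filter (Finset (Fin d → ℤ))),
        ∀ x ∈ Finset.image₂ (fun a b => a + b) T B, Z Λ x = X x :=
      (Filter.eventually_all_finset _).2 fun x _ => hX x
    obtain ⟨Λ, hTΛ, hΛ⟩ := (h₁.and h₂).exists
    let V : (Fin d → ℤ) → S := fun x => if x ∈ D then Y x else Z Λ x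
    have hZX : ∀ a ∈ T, window B (Z Λ) a = window B X a := fun a ha => funext fun b =>
      hΛ _ (Finset.mem_image₂_of_mem ha b.2)
    have hVY : ∀ a ∈ T, window B V a = window B Y a := fun a ha => funext fun b => by
      by_cases h : a + (b : Fin d → ℤ) ∈ D
      · simp [window, V, h]
      · simpa [window, V, h, hD _ h] using hΛ _ (Finset.mem_image₂_of_mem ha b.2)
    have hVZ : ∀ a, a ∉ T → window B V a = window B (Z Λ) a := fun a ha => funext fun b => by
      simp [window, V, hT a ha b b.2]
    calc 0 ≤ ∑ a ∈ Λ, (f (window B V a) - f (window B (Z Λ) a)) := by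
            rw [Finset.sum_sub_distrib]
            exact sub_nonneg.2 (hZ Λ V)
      _ = ∑ a ∈ T, (f (window B V a) - f (window B (Z Λ) a)) :=
            (Finset.sum_subset hTΛ fun a _ ha => by rw [hVZ a ha, sub_self]).symm
      _ = ∑ a ∈ T, (f (window B Y a) - f (window B X a)) :=
            Finset.sum_congr rfl fun a ha => by rw [hVY a ha, hZX a ha]
  · intro a ha
    by_contra h
    have hw : window B Y a = window B X a := funext fun b => hD _ (hT a h b b.2)
    exact ha (sub_eq_zero.2 (congrArg f hw))
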